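/- Let E be a Polish space and W ∈ L¹₊[0,1]² a nonnegative kernel. Assume: the step kernels W_{ξⁿ} converge to W in the strong operator topology; (1/n³) Σ_{i,j=1}^n (ξⁿ_{ij})² → 0; the map [0,1] ∋ u ↦ W(u,v)dv ∈ M₊([0,1]) is weakly continuous; and μ ∈ P_Unif([0,1] × E) admits a disintegration u ↦ μ_u that is weakly continuous. Let h : [0,1] × M₊(E) → ℝ be bounded and measurable, with h(u,·) continuous on M₊(E) uniformly in u, i.e. lim_{m'→m} sup_{u∈[0,1]} |h(u,m') − h(u,m)| = 0 for every m ∈ M₊(E). Then lim_{n→∞} sup_{(u₁,…,uₙ) ∈ Iⁿ₁×⋯×Iⁿₙ} (1/n) Σ_{i=1}^n E| h(uᵢ, M^{n,u}ᵢ) − h(uᵢ, Wμ(uᵢ)) | = 0. -/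

import Mathlib

open MeasureTheory ProbabilityTheory Filter Set
open scoped NNReal ENNReal Topology

noncomputable section

/-- The uniform (Lebesgue) measure on `[0,1]`, as a measure on `ℝ`. -/
def unif01 : Measure ℝ := volume.restrict (Set.Icc 0 1)

/-- `Iseg n i` is the interval `Iⁿ_{i+1} = [i/n, (i+1)/n)` (`0`-indexed); the last one is
`[(n-1)/n, 1]`. -/
def Iseg (n i : ℕ) : Set ℝ :=
  if i + 1 = n then Set.Icc ((i : ℝ) / n) 1 else Set.Ico ((i : ℝ) / n) (((i : ℝ) + 1) / n)

/-- The index `i` such that `u ∈ Iseg n i`, for `u ∈ [0,1]`. -/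
def idx (n : ℕ) (u : ℝ) : ℕ := min (n - 1) ⌊(n : ℝ) * u⌋₊

/-- The step kernel `W_ξ` associated with an `n × n` matrix `ξ` with nonnegative entries. -/
def Wstep (n : ℕ) (ξ : ℕ → ℕ → ℝ≥0) : ℝ → ℝ → ℝ := fun u v => (ξ (idx n u) (idx n v) : ℝ)

/-- Convergence of kernels in the strong operator topology, for operators `L^∞[0,1] → L¹[0,1]`:
`∫₀¹ |∫₀¹ (Wₙ(u,v) − W(u,v)) ψ(v) dv| du → 0` for every bounded measurable `ψ`. -/
def StrongOpTendsto (Wn : ℕ → ℝ → ℝ → ℝ) (W : ℝ → ℝ → ℝ) : Prop :=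
  ∀ ψ : ℝ → ℝ, Measurable ψ → (∃ C, ∀ v, |ψ v| ≤ C) →
    Tendsto (fun n => ∫ u, |∫ v, (Wn n u v - W u v) * ψ v ∂unif01| ∂unif01) atTop (𝓝 0)

/-- The measure `Wm(u)` on `E` associated with a kernel `W` and a measure `m` on `[0,1] × E`:
it integrates a function `φ` to `∫_{[0,1]×E} W(u,v) φ(x) m(dv,dx)`. -/
def Wmeas {E : Type*} [MeasurableSpace E] (W : ℝ → ℝ → ℝ) (m : Measure (ℝ × E)) (u : ℝ) :
    Measure E :=
  (m.withDensity fun p => ENNReal.ofReal (W u p.1)).map Prod.snd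

open Classical in
/-- The measure `Wm(u)`, packaged as a finite measure (junk value `0` on the null set of labels
`u` where it is not finite). -/
def Wfin {E : Type*} [MeasurableSpace E] (W : ℝ → ℝ → ℝ) (m : Measure (ℝ × E)) (u : ℝ) :
    FiniteMeasure E :=
  if h : IsFiniteMeasure (Wmeas W m u) then ⟨Wmeas W m u, h⟩ else 0

/-- Dirac mass as a finite measure. -/
def diracFM {E : Type*} [MeasurableSpace E] (x : E) : FiniteMeasure E :=
  ⟨Measure.dirac x, inferInstance⟩

/-- Borel σ-algebra on the space of finite measures with its weak topology. -/
instance {X : Type*} [MeasurableSpace X] [TopologicalSpace X] [OpensMeasurableSpace X] :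
    MeasurableSpace (FiniteMeasure X) := borel _
theorem FiniteMeasure.exists_finset_testAgainstNN_of_mem_nhds {Ω : Type*} [MeasurableSpace Ω]
    [TopologicalSpace Ω] [OpensMeasurableSpace Ω] {m : FiniteMeasure Ω}
    {s : Set (FiniteMeasure Ω)} (hs : s ∈ 𝓝 m) :
    ∃ Φ : Finset (BoundedContinuousFunction Ω ℝ≥0), ∃ δ > (0 : ℝ), ∀ m' : FiniteMeasure Ω,
      (∀ φ ∈ Φ, |(m'.testAgainstNN φ : ℝ) - m.testAgainstNN φ| < δ) → m' ∈ s := by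
  have hle : (⨅ φ : BoundedContinuousFunction Ω ℝ≥0,
      comap (fun m' : FiniteMeasure Ω => m'.testAgainstNN φ) (𝓝 (m.testAgainstNN φ))) ≤ 𝓝 m := by
    refine FiniteMeasure.tendsto_iff_forall_testAgainstNN_tendsto (μs := id).2 fun φ => ?_
    exact tendsto_comap.mono_left (iInf_le _ φ)
  obtain ⟨t, ht⟩ := (mem_iInf_finite _).1 (hle hs)
  obtain ⟨p, hp, rfl⟩ := mem_iInf_finset.1 ht
  have hδ : ∀ φ ∈ t, ∀ᶠ δ in 𝓝[>] (0 : ℝ), ∀ m' : FiniteMeasure Ω,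
      |(m'.testAgainstNN φ : ℝ) - m.testAgainstNN φ| < δ → m' ∈ p φ := by
    intro φ hφ
    obtain ⟨V, hV, hVp⟩ := mem_comap.1 (hp φ hφ)
    obtain ⟨r, hr, hrV⟩ := Metric.mem_nhds_iff.1 hV
    filter_upwards [Ioo_mem_nhdsGT hr] with δ hδ m' hm'
    refine hVp (hrV ?_)
    rw [Metric.mem_ball, NNReal.dist_eq]
    exact hm'.trans hδ.2
  obtain ⟨δ, hδ, hδ0⟩ :=
    (((Filter.eventually_all_finset t).2 hδ).and self_mem_nhdsWithin).exists
  refine ⟨t, δ, hδ0, fun m' hm' => ?_⟩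
  simp only [mem_iInter]
  exact fun φ hφ => hδ φ hφ m' (hm' φ hφ)

/-- A family of functions that is continuous uniformly in its index is, near the image of a compact
set under a continuous map, controlled by finitely many test functions with one tolerance. -/
theorem exists_finset_test_uniform {ι X Ω : Type*} [TopologicalSpace X] [MeasurableSpace Ω]
    [TopologicalSpace Ω] [OpensMeasurableSpace Ω] {I : Set ι} {h : ι → FiniteMeasure Ω → ℝ}
    (hh : ∀ m : FiniteMeasure Ω, ∀ ε > (0 : ℝ),
      ∀ᶠ m' in 𝓝 m, ∀ u ∈ I, |h u m' - h u m| ≤ ε)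
    {K : Set X} (hK : IsCompact K) {M : X → FiniteMeasure Ω} (hM : ContinuousOn M K)
    {ε : ℝ} (hε : 0 < ε) :
    ∃ Φ : Finset (BoundedContinuousFunction Ω ℝ≥0), ∃ δ > (0 : ℝ), ∀ t ∈ K,
      ∀ m' : FiniteMeasure Ω,
        (∀ φ ∈ Φ, |(m'.testAgainstNN φ : ℝ) - (M t).testAgainstNN φ| < δ) →
          ∀ u ∈ I, |h u m' - h u (M t)| ≤ ε := by
  classical
  refine hK.induction_on (p := fun s => ∃ Φ : Finset (BoundedContinuousFunction Ω ℝ≥0),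
    ∃ δ > (0 : ℝ), ∀ t ∈ s, ∀ m' : FiniteMeasure Ω,
        (∀ φ ∈ Φ, |(m'.testAgainstNN φ : ℝ) - (M t).testAgainstNN φ| < δ) →
          ∀ u ∈ I, |h u m' - h u (M t)| ≤ ε) ?_ ?_ ?_ ?_
  · exact ⟨∅, 1, one_pos, by simp⟩
  · rintro s t hst ⟨Φ, δ, hδ, H⟩
    exact ⟨Φ, δ, hδ, fun x hx => H x (hst hx)⟩
  · rintro s t ⟨Φ, δ, hδ, H⟩ ⟨Φ', δ', hδ', H'⟩
    refine ⟨Φ ∪ Φ', min δ δ', lt_min hδ hδ', ?_⟩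
    rintro x (hx | hx) m' hm'
    · exact H x hx m' fun φ hφ =>
        (hm' φ (Finset.mem_union_left _ hφ)).trans_le (min_le_left _ _)
    · exact H' x hx m' fun φ hφ =>
        (hm' φ (Finset.mem_union_right _ hφ)).trans_le (min_le_right _ _)
  · intro t₀ ht₀
    obtain ⟨Φ, δ, hδ, H⟩ :=
      FiniteMeasure.exists_finset_testAgainstNN_of_mem_nhds (hh (M t₀) (ε / 2) (half_pos hε))
    have hnear : ∀ φ ∈ Φ, ∀ᶠ t in 𝓝[K] t₀,
        |((M t).testAgainstNN φ : ℝ) - (M t₀).testAgainstNN φ| < δ / 2 := by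
      intro φ _
      have hc := (FiniteMeasure.tendsto_iff_forall_testAgainstNN_tendsto.1 (hM t₀ ht₀)) φ
      filter_upwards [Metric.tendsto_nhds.1 hc (δ / 2) (half_pos hδ)] with t ht
      rwa [NNReal.dist_eq] at ht
    refine ⟨_, (Filter.eventually_all_finset Φ).2 hnear, Φ, δ / 2, half_pos hδ, ?_⟩
    intro t ht m' hm' u hu
    have h1 : |h u (M t) - h u (M t₀)| ≤ ε / 2 :=
      H (M t) (fun φ hφ => (ht φ hφ).trans (half_lt_self hδ)) u hu
    have h2 : |h u m' - h u (M t₀)| ≤ ε / 2 := by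
      refine H m' (fun φ hφ => ?_) u hu
      have := abs_sub_le (m'.testAgainstNN φ : ℝ) ((M t).testAgainstNN φ)
        ((M t₀).testAgainstNN φ)
      linarith [hm' φ hφ, ht φ hφ]
    have := abs_sub_le (h u m') (h u (M t₀)) (h u (M t))
    rw [abs_sub_comm (h u (M t₀))] at this
    linarith

/-- An integrable function with nonnegative integrals against all nonnegative bounded continuous
functions is nonnegative almost everywhere. -/
theorem ae_nonneg_of_forall_integral_mul_nonneg {X : Type*} [MetricSpace X] [MeasurableSpace X]
    [BorelSpace X] {ν : Measure X} {f : X → ℝ} (hfm : Measurable f) (hf : Integrable f ν)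
    (hpos : ∀ g : BoundedContinuousFunction X ℝ≥0, 0 ≤ ∫ x, f x * g x ∂ν) :
    0 ≤ᵐ[ν] f := by
  have hfm' : Measurable fun x => ENNReal.ofReal (-f x) := hfm.neg.ennreal_ofReal
  set ν₁ := ν.withDensity fun x => ENNReal.ofReal (f x) with hν₁
  set ν₂ := ν.withDensity fun x => ENNReal.ofReal (-f x) with hν₂
  have : IsFiniteMeasure ν₁ := isFiniteMeasure_withDensity_ofReal hf.2
  have : IsFiniteMeasure ν₂ := isFiniteMeasure_withDensity_ofReal hf.neg.2
  have hle : ∀ g : BoundedContinuousFunction X ℝ≥0, ∫⁻ x, g x ∂ν₂ ≤ ∫⁻ x, g x ∂ν₁ := by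
    intro g
    have hgm : Measurable fun x => (g x : ℝ≥0∞) :=
      measurable_coe_nnreal_ennreal.comp g.continuous.measurable
    have hfg : Integrable (fun x => f x * g x) ν := by
      refine hf.mul_bdd (c := (nndist g 0 : ℝ))
        (measurable_coe_nnreal_real.comp g.continuous.measurable).aestronglyMeasurable
        (ae_of_all _ fun x => ?_)
      rw [Real.norm_of_nonneg (g x).coe_nonneg]
      exact_mod_cast BoundedContinuousFunction.NNReal.upper_bound g x
    rw [lintegral_withDensity_eq_lintegral_mul _ hfm.ennreal_ofReal hgm,
      lintegral_withDensity_eq_lintegral_mul _ hfm' hgm]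
    have e1 : ∀ x, ((fun x => ENNReal.ofReal (f x)) * fun x => (g x : ℝ≥0∞)) x
        = ENNReal.ofReal (f x * g x) := fun x => by
      simp [ENNReal.ofReal_mul' (g x).coe_nonneg]
    have e2 : ∀ x, ((fun x => ENNReal.ofReal (-f x)) * fun x => (g x : ℝ≥0∞)) x
        = ENNReal.ofReal (-(f x * g x)) := fun x => by
      simp [← neg_mul, ENNReal.ofReal_mul' (g x).coe_nonneg]
    simp only [e1, e2]
    have := hpos g
    rw [integral_eq_lintegral_pos_part_sub_lintegral_neg_part hfg, sub_nonneg] at this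
    refine (ENNReal.toReal_le_toReal ?_ ?_).1 this
    · exact hfg.neg.lintegral_lt_top.ne
    · exact hfg.lintegral_lt_top.ne
  have hclosed : ∀ F : Set X, IsClosed F → ν₂ F ≤ ν₁ F := by
    intro F hF
    have hδ : ∀ n : ℕ, (0 : ℝ) < 1 / ((n : ℝ) + 1) := fun n => Nat.one_div_pos_of_nat
    exact le_of_tendsto_of_tendsto'
      (tendsto_lintegral_thickenedIndicator_of_isClosed ν₂ hF hδ
        tendsto_one_div_add_atTop_nhds_zero_nat)
      (tendsto_lintegral_thickenedIndicator_of_isClosed ν₁ hF hδ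
        tendsto_one_div_add_atTop_nhds_zero_nat) fun n => hle _
  set A : Set X := {x | f x < 0}
  have hA : MeasurableSet A := measurableSet_lt hfm measurable_const
  have hA1 : ν₁ A = 0 := by
    rw [hν₁, withDensity_apply _ hA]
    exact setLIntegral_eq_zero hA fun x hx => ENNReal.ofReal_of_nonpos (le_of_lt hx)
  have hA2 : ν₂ A = 0 := by
    by_contra hne
    obtain ⟨K, hKA, hK, hlt⟩ := hA.exists_lt_isClosed_of_ne_top (measure_ne_top ν₂ A)
      (pos_iff_ne_zero.2 hne)
    exact absurd ((hclosed K hK).trans (measure_mono hKA)) (by rw [hA1]; exact not_le.2 hlt)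
  rw [hν₂, withDensity_apply_eq_zero hfm'] at hA2
  rw [Filter.EventuallyLE, ae_iff]
  refine measure_mono_null (fun x hx => ?_) hA2
  have hx' : f x < 0 := not_le.1 hx
  exact ⟨by simpa using hx', hx'⟩

instance : IsProbabilityMeasure unif01 := ⟨by simp [unif01]⟩

theorem ae_unif01_mem_Icc : ∀ᵐ v ∂unif01, v ∈ Set.Icc (0 : ℝ) 1 :=
  ae_restrict_mem measurableSet_Icc

theorem ContinuousOn.integrable_unif01 {f : ℝ → ℝ} (hf : ContinuousOn f (Set.Icc 0 1)) :
    Integrable f unif01 :=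
  hf.integrableOn_Icc

theorem idx_lt {n : ℕ} (hn : 0 < n) (u : ℝ) : idx n u < n :=
  (min_le_left _ _).trans_lt (Nat.sub_lt hn one_pos)

theorem measurable_idx (n : ℕ) : Measurable (idx n) := by
  unfold idx
  exact measurable_const.min (Nat.measurable_floor.comp (measurable_const.mul measurable_id))

theorem idx_bounds {n : ℕ} (hn : 0 < n) {u : ℝ} (hu : u ∈ Set.Icc (0 : ℝ) 1) :
    (idx n u : ℝ) / n ≤ u ∧ u ≤ ((idx n u : ℝ) + 1) / n := by
  have hn' : (0 : ℝ) < n := Nat.cast_pos.2 hn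
  have hnu : 0 ≤ (n : ℝ) * u := mul_nonneg hn'.le hu.1
  rw [div_le_iff₀ hn', le_div_iff₀ hn']
  constructor
  · calc (idx n u : ℝ) ≤ ⌊(n : ℝ) * u⌋₊ := Nat.cast_le.2 (min_le_right _ _)
      _ ≤ n * u := Nat.floor_le hnu
      _ = u * n := mul_comm _ _
  · unfold idx
    rcases min_choice (n - 1) ⌊(n : ℝ) * u⌋₊ with h | h <;> rw [h]
    · rw [← Nat.cast_add_one, Nat.sub_add_cancel hn]
      nlinarith [hu.2]
    · rw [mul_comm]
      exact (Nat.lt_floor_add_one _).le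

theorem Iseg_bounds {n i : ℕ} (hi : i < n) {u : ℝ} (hu : u ∈ Iseg n i) :
    (i : ℝ) / n ≤ u ∧ u ≤ ((i : ℝ) + 1) / n := by
  have hn' : (0 : ℝ) < n := Nat.cast_pos.2 (i.zero_le.trans_lt hi)
  unfold Iseg at hu
  split_ifs at hu with h
  · rw [← Nat.cast_add_one, h, div_self hn'.ne']
    exact hu
  · exact ⟨hu.1, hu.2.le⟩

theorem Iseg_subset_Icc {n i : ℕ} (hi : i < n) : Iseg n i ⊆ Set.Icc (0 : ℝ) 1 := by
  intro u hu
  have hn' : (0 : ℝ) < n := Nat.cast_pos.2 (i.zero_le.trans_lt hi)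
  obtain ⟨h1, h2⟩ := Iseg_bounds hi hu
  refine ⟨le_trans (by positivity) h1, h2.trans ?_⟩
  rw [div_le_one hn']
  exact_mod_cast hi

theorem abs_sub_le_of_mem_Iseg_idx {n : ℕ} (hn : 0 < n) {u v : ℝ} (hv : v ∈ Set.Icc (0 : ℝ) 1)
    (hu : u ∈ Iseg n (idx n v)) : |u - v| ≤ 1 / n := by
  have h1 := idx_bounds hn hv
  have h2 := Iseg_bounds (idx_lt hn v) hu
  rw [add_div] at h1 h2
  rw [abs_le]
  constructor <;> linarith [h1.1, h1.2, h2.1, h2.2]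

theorem integrable_comp_idx {n : ℕ} (hn : 0 < n) (F : ℕ → ℝ) :
    Integrable (fun u => F (idx n u)) unif01 := by
  refine Integrable.of_bound
    ((measurable_of_countable F).comp (measurable_idx n)).aestronglyMeasurable
    (∑ i ∈ Finset.range n, |F i|) (ae_of_all _ fun u => ?_)
  exact Finset.single_le_sum (f := fun i => |F i|) (fun i _ => abs_nonneg _)
    (Finset.mem_range.2 (idx_lt hn u))

theorem integral_comp_idx {n : ℕ} (hn : 0 < n) (F : ℕ → ℝ) :
    ∫ u, F (idx n u) ∂unif01 = (1 / (n : ℝ)) * ∑ i ∈ Finset.range n, F i := by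
  have hn' : (0 : ℝ) < n := Nat.cast_pos.2 hn
  have hF : IntervalIntegrable (fun u => F (idx n u)) volume 0 1 := by
    rw [intervalIntegrable_iff_integrableOn_Icc_of_le zero_le_one]
    exact integrable_comp_idx hn F
  have hcell : ∀ k < n, ∫ u in ((k : ℝ) / n)..(((k + 1 : ℕ) : ℝ) / n), F (idx n u)
      = 1 / (n : ℝ) * F k := by
    intro k hk
    have hle : (k : ℝ) / n ≤ ((k + 1 : ℕ) : ℝ) / n := by gcongr; simp
    have hc : ∫ u in ((k : ℝ) / n)..(((k + 1 : ℕ) : ℝ) / n), F (idx n u)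
        = ∫ _ in ((k : ℝ) / n)..(((k + 1 : ℕ) : ℝ) / n), F k := by
      rw [intervalIntegral.integral_of_le hle, intervalIntegral.integral_of_le hle,
        integral_Ioc_eq_integral_Ioo, integral_Ioc_eq_integral_Ioo]
      refine setIntegral_congr_fun measurableSet_Ioo fun u hu => ?_
      have h1 : (k : ℝ) ≤ n * u := by
        have := (div_lt_iff₀ hn').1 hu.1
        linarith
      have h2 : (n : ℝ) * u < k + 1 := by
        have := (lt_div_iff₀ hn').1 hu.2
        push_cast at this
        linarith
      have hfl : ⌊(n : ℝ) * u⌋₊ = k := (Nat.floor_eq_iff (k.cast_nonneg.trans h1)).2 ⟨h1, h2⟩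
      have : idx n u = k := by
        rw [idx, hfl]
        exact min_eq_right (Nat.le_sub_one_of_lt hk)
      simp only [this]
    rw [hc, intervalIntegral.integral_const, smul_eq_mul]
    push_cast
    congr 1
    field_simp
    ring
  have hsum := intervalIntegral.sum_integral_adjacent_intervals (μ := volume)
    (f := fun u => F (idx n u)) (a := fun k : ℕ => (k : ℝ) / n) (n := n) (fun k hk => by
      refine hF.mono_set ?_
      rw [uIcc_of_le zero_le_one, uIcc_of_le (by gcongr; simp)]
      refine Icc_subset_Icc (by positivity) ?_
      rw [div_le_one hn']
      exact_mod_cast hk)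
  simp only [Nat.cast_zero, zero_div, div_self hn'.ne'] at hsum
  rw [unif01, integral_Icc_eq_integral_Ioc, ← intervalIntegral.integral_of_le zero_le_one, ← hsum,
    Finset.mul_sum]
  exact Finset.sum_congr rfl fun k hk => hcell k (Finset.mem_range.1 hk)

/-- First-moment form of Chebyshev's inequality for weighted sums of independent bounded random
variables, realized on a product space. -/
theorem integral_abs_sum_sub_le {ι Ω : Type*} [Fintype ι] [MeasurableSpace Ω]
    (p : ι → Measure Ω) [∀ i, IsProbabilityMeasure (p i)] {φ : Ω → ℝ} (hφ : Measurable φ) {B : ℝ}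
    (hB : ∀ x, |φ x| ≤ B) (a : ι → ℝ) {η : ℝ} (hη : 0 < η) :
    Integrable (fun x : ι → Ω => |∑ j, a j * φ (x j) - ∑ j, a j * ∫ y, φ y ∂p j|)
      (Measure.pi p) ∧
    ∫ x : ι → Ω, |∑ j, a j * φ (x j) - ∑ j, a j * ∫ y, φ y ∂p j| ∂Measure.pi p
      ≤ η + B ^ 2 / η * ∑ j, a j ^ 2 := by
  have hφL : ∀ j, MemLp φ 2 (p j) := fun j =>
    MemLp.of_bound hφ.aestronglyMeasurable B (ae_of_all _ hB)
  have hL : ∀ j, MemLp (fun x => a j * φ x) 2 (p j) := fun j => (hφL j).const_mul (a j)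
  have hLpi : ∀ j, MemLp (fun x : ι → Ω => a j * φ (x j)) 2 (Measure.pi p) := fun j =>
    (hL j).comp_measurePreserving (measurePreserving_eval p j)
  have hS : MemLp (fun x : ι → Ω => ∑ j, a j * φ (x j)) 2 (Measure.pi p) :=
    memLp_finsetSum _ fun j _ => hLpi j
  set c : ℝ := ∑ j, a j * ∫ y, φ y ∂p j with hc
  have hmean : ∫ x : ι → Ω, ∑ j, a j * φ (x j) ∂Measure.pi p = c := by
    rw [integral_finsetSum _ fun j _ => (hLpi j).integrable one_le_two, hc]
    refine Finset.sum_congr rfl fun j _ => ?_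
    rw [integral_const_mul, integral_comp_eval hφ.aestronglyMeasurable]
  have hD : MemLp (fun x : ι → Ω => ∑ j, a j * φ (x j) - c) 2 (Measure.pi p) :=
    hS.sub (memLp_const c)
  have hvar : ∫ x : ι → Ω, (∑ j, a j * φ (x j) - c) ^ 2 ∂Measure.pi p
      ≤ B ^ 2 * ∑ j, a j ^ 2 := by
    have h1 := variance_sum_pi hL
    have h2 : (∑ j, fun x : ι → Ω => a j * φ (x j)) = fun x => ∑ j, a j * φ (x j) := by
      ext x; simp
    rw [h2, variance_eq_integral hS.aestronglyMeasurable.aemeasurable, hmean] at h1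
    rw [h1, Finset.mul_sum]
    refine Finset.sum_le_sum fun j _ => ?_
    rw [variance_const_mul, mul_comm]
    gcongr
    refine (variance_le_expectation_sq hφ.aestronglyMeasurable).trans ?_
    calc ∫ x, (φ ^ 2) x ∂p j ≤ ∫ _, B ^ 2 ∂p j := by
          refine integral_mono_of_nonneg (ae_of_all _ fun x => sq_nonneg (φ x))
            (integrable_const _) (ae_of_all _ fun x => ?_)
          exact sq_le_sq' (abs_le.1 (hB x)).1 (abs_le.1 (hB x)).2
      _ = B ^ 2 := by simp
  refine ⟨(hD.integrable one_le_two).abs, ?_⟩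
  calc ∫ x : ι → Ω, |∑ j, a j * φ (x j) - c| ∂Measure.pi p
      ≤ ∫ x : ι → Ω, (η + (1 / η) * (∑ j, a j * φ (x j) - c) ^ 2) ∂Measure.pi p := by
        refine integral_mono (hD.integrable one_le_two).abs
          ((integrable_const _).add (hD.integrable_sq.const_mul _)) fun x => ?_
        generalize ∑ j, a j * φ (x j) - c = s
        change |s| ≤ η + 1 / η * s ^ 2
        rw [← sq_abs s]
        have : η + 1 / η * |s| ^ 2 - |s| = ((|s| - η / 2) ^ 2 + 3 / 4 * η ^ 2) / η := by
          field_simp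
          ring
        have h0 : 0 ≤ ((|s| - η / 2) ^ 2 + 3 / 4 * η ^ 2) / η := by positivity
        linarith
    _ = η + (1 / η) * ∫ x : ι → Ω, (∑ j, a j * φ (x j) - c) ^ 2 ∂Measure.pi p := by
        rw [integral_add (integrable_const _) (hD.integrable_sq.const_mul _), integral_const_mul]
        simp
    _ ≤ η + (1 / η) * (B ^ 2 * ∑ j, a j ^ 2) := by gcongr
    _ = η + B ^ 2 / η * ∑ j, a j ^ 2 := by ring

section Kernel

variable {W : ℝ → ℝ → ℝ}

theorem ae_nonneg_slice_of_continuous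
    (hWmeas : Measurable fun p : ℝ × ℝ => W p.1 p.2)
    (hWnonneg : ∀ᵐ p ∂unif01.prod unif01, 0 ≤ W p.1 p.2)
    (hWslice : ∀ u ∈ Set.Icc (0 : ℝ) 1, Integrable (W u) unif01)
    (hWcont : ∀ g : ℝ → ℝ, Continuous g →
      ContinuousOn (fun u => ∫ v, W u v * g v ∂unif01) (Set.Icc (0 : ℝ) 1))
    {u : ℝ} (hu : u ∈ Set.Icc (0 : ℝ) 1) : 0 ≤ᵐ[unif01] W u := by
  refine ae_nonneg_of_forall_integral_mul_nonneg hWmeas.of_uncurry_left (hWslice u hu) fun g => ?_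
  have hG := hWcont (fun v => (g v : ℝ)) (NNReal.continuous_coe.comp g.continuous)
  set G : ℝ → ℝ := fun u => ∫ v, W u v * g v ∂unif01
  have hae : ∀ᵐ t ∂unif01, 0 ≤ G t := by
    filter_upwards [Measure.ae_ae_of_ae_prod hWnonneg] with t ht
    refine integral_nonneg_of_ae ?_
    filter_upwards [ht] with v hv using mul_nonneg hv (g v).coe_nonneg
  by_contra hneg
  have hneg : G u < 0 := not_le.1 hneg
  have hnear : ∀ᶠ t in 𝓝[Set.Icc 0 1] u, G t < 0 := (hG u hu).eventually (gt_mem_nhds hneg)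
  obtain ⟨O, hO, hOu, hOsub⟩ := mem_nhdsWithin.1 hnear
  have hclos : u ∈ closure (Set.Ioo (0 : ℝ) 1) := by
    rwa [closure_Ioo zero_ne_one]
  obtain ⟨t, htO, htI⟩ := mem_closure_iff.1 hclos O hO hOu
  have hpos : 0 < volume (O ∩ Set.Ioo (0 : ℝ) 1) :=
    (hO.inter isOpen_Ioo).measure_pos volume ⟨t, htO, htI⟩
  have hzero : unif01 (O ∩ Set.Ioo (0 : ℝ) 1) = 0 := by
    refine measure_mono_null (fun s hs => ?_) (ae_iff.1 hae)
    exact not_le.2 (hOsub ⟨hs.1, Ioo_subset_Icc_self hs.2⟩)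
  rw [unif01, Measure.restrict_eq_self _
    (inter_subset_right.trans Ioo_subset_Icc_self)] at hzero
  exact hpos.ne' hzero

variable {E : Type*} [MeasurableSpace E]

theorem lintegral_Wmeas_of_disintegration {μ : Measure (ℝ × E)} {κ : ℝ → ProbabilityMeasure E}
    (hκ : Measurable fun u => (κ u : Measure E))
    (hdis : μ = unif01.bind fun u => (κ u : Measure E).map fun x => (u, x))
    {u : ℝ} (hWu : Measurable (W u)) {f : E → ℝ≥0∞} (hf : Measurable f) :
    ∫⁻ x, f x ∂Wmeas W μ u
      = ∫⁻ v, ENNReal.ofReal (W u v) * ∫⁻ x, f x ∂(κ v : Measure E) ∂unif01 := by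
  have hpair : Measurable fun v => (κ v : Measure E).map fun x => (v, x) := by
    let K : ProbabilityTheory.Kernel ℝ E := ⟨fun u => (κ u : Measure E), hκ⟩
    have : IsMarkovKernel K := ⟨fun u => inferInstanceAs (IsProbabilityMeasure (κ u : Measure E))⟩
    have h : (fun v => (κ v : Measure E).map fun x => (v, x)) = ⇑(Kernel.id ×ₖ K) := by
      ext1 v
      rw [Kernel.prod_apply, Kernel.id_apply, Measure.dirac_prod]
      rfl
    rw [h]
    exact Kernel.measurable _
  have hden : Measurable fun p : ℝ × E => ENNReal.ofReal (W u p.1) :=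
    (hWu.comp measurable_fst).ennreal_ofReal
  have hf2 : Measurable fun p : ℝ × E => f p.2 := hf.comp measurable_snd
  rw [Wmeas, lintegral_map hf measurable_snd, lintegral_withDensity_eq_lintegral_mul _ hden hf2,
    hdis, Measure.lintegral_bind hpair.aemeasurable (hden.mul hf2).aemeasurable]
  refine lintegral_congr fun v => ?_
  rw [lintegral_map (hden.mul hf2) measurable_prodMk_left]
  simp only [Pi.mul_apply]
  exact lintegral_const_mul _ hf

variable [TopologicalSpace E] [OpensMeasurableSpace E]

theorem testAgainstNN_Wfin {μ : Measure (ℝ × E)} {κ : ℝ → ProbabilityMeasure E}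
    (hκ : Measurable fun u => (κ u : Measure E))
    (hdis : μ = unif01.bind fun u => (κ u : Measure E).map fun x => (u, x))
    {u : ℝ} (hWu : Measurable (W u)) (hint : Integrable (W u) unif01)
    (hpos : 0 ≤ᵐ[unif01] W u) (φ : BoundedContinuousFunction E ℝ≥0) :
    ((Wfin W μ u).testAgainstNN φ : ℝ)
      = ∫ v, W u v * ((κ v).toFiniteMeasure.testAgainstNN φ : ℝ) ∂unif01 := by
  have hfin : IsFiniteMeasure (Wmeas W μ u) := by
    constructor
    rw [← lintegral_one, lintegral_Wmeas_of_disintegration hκ hdis hWu (f := fun _ => 1) measurable_const]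
    simpa using hint.lintegral_lt_top
  have hφ : Measurable fun x => (φ x : ℝ≥0∞) :=
    measurable_coe_nnreal_ennreal.comp φ.continuous.measurable
  have hg : Measurable fun v => (κ v).toFiniteMeasure.testAgainstNN φ :=
    ((Measure.measurable_lintegral hφ).comp hκ).ennreal_toNNReal
  have hWf : (Wfin W μ u : Measure E) = Wmeas W μ u := by
    have h : Wfin W μ u = ⟨Wmeas W μ u, hfin⟩ := dif_pos hfin
    rw [h]
    rfl
  rw [integral_eq_lintegral_of_nonneg_ae]
  · rw [← ENNReal.coe_toReal, FiniteMeasure.testAgainstNN_coe_eq, hWf,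
      lintegral_Wmeas_of_disintegration hκ hdis hWu hφ]
    congr 1
    refine lintegral_congr fun v => ?_
    rw [ENNReal.ofReal_mul' (NNReal.coe_nonneg _), ENNReal.ofReal_coe_nnreal,
      FiniteMeasure.testAgainstNN_coe_eq]
    rfl
  · filter_upwards [hpos] with v hv using mul_nonneg hv (NNReal.coe_nonneg _)
  · exact (hWu.mul (measurable_coe_nnreal_real.comp hg)).aestronglyMeasurable

end Kernel

/-- Quadrature form of strong operator convergence: for continuous `g`, the discrete operators
sampled at arbitrary points of the cells approximate the limiting operator uniformly in the sampling
points. -/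
theorem StrongOpTendsto.discrete {W : ℝ → ℝ → ℝ} {ξ : ℕ → ℕ → ℕ → ℝ≥0}
    (hconv : StrongOpTendsto (fun n => Wstep n (ξ n)) W)
    (hWslice : ∀ u ∈ Set.Icc (0 : ℝ) 1, Integrable (W u) unif01)
    (hWcont : ∀ g : ℝ → ℝ, Continuous g →
      ContinuousOn (fun u => ∫ v, W u v * g v ∂unif01) (Set.Icc (0 : ℝ) 1))
    {g : ℝ → ℝ} (hg : Continuous g) {B : ℝ} (hB : ∀ v, |g v| ≤ B) {ε : ℝ} (hε : 0 < ε) :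
    ∀ᶠ n : ℕ in atTop, ∀ u : ℕ → ℝ, (∀ i < n, u i ∈ Iseg n i) →
      (1 / (n : ℝ)) * ∑ i ∈ Finset.range n,
        |(1 / (n : ℝ)) * ∑ j ∈ Finset.range n, (ξ n i j : ℝ) * g (u j)
          - ∫ v, W (u i) v * g v ∂unif01| < ε := by
  set G : ℝ → ℝ := fun u => ∫ v, W u v * g v ∂unif01 with hG
  set G₁ : ℝ → ℝ := fun u => ∫ v, W u v * 1 ∂unif01 with hG₁
  have hGc : ContinuousOn G (Set.Icc 0 1) := hWcont g hg
  have hG₁c : ContinuousOn G₁ (Set.Icc 0 1) := hWcont (fun _ => 1) continuous_const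
  obtain ⟨B₁, hB₁⟩ := isCompact_Icc.exists_bound_of_continuousOn hG₁c
  have hB₁0 : 0 ≤ B₁ := (norm_nonneg _).trans (hB₁ 0 (by simp))
  set η : ℝ := ε / (4 + B₁) with hη
  have hη0 : 0 < η := by positivity
  have hunif : ∀ {f : ℝ → ℝ}, ContinuousOn f (Set.Icc 0 1) → ∃ δ > 0, ∀ x ∈ Set.Icc (0 : ℝ) 1,
      ∀ y ∈ Set.Icc (0 : ℝ) 1, |x - y| < δ → |f x - f y| < η := fun hf => by
    have := Metric.uniformContinuousOn_iff.1 (isCompact_Icc.uniformContinuousOn_of_continuous hf)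
      η hη0
    simpa only [Real.dist_eq] using this
  obtain ⟨δ, hδ0, hδ⟩ := hunif hGc
  obtain ⟨δ', hδ'0, hδ'⟩ := hunif hg.continuousOn
  have hconv_g := (hconv g hg.measurable ⟨B, hB⟩).eventually (gt_mem_nhds hη0)
  have hconv_one := (hconv (fun _ => 1) measurable_const ⟨1, by simp⟩).eventually
    (gt_mem_nhds one_pos)
  have hsmall := tendsto_one_div_atTop_nhds_zero_nat.eventually
    (gt_mem_nhds (lt_min hδ0 hδ'0) : ∀ᶠ x in 𝓝 (0 : ℝ), x < min δ δ')
  filter_upwards [hconv_g, hconv_one, hsmall, eventually_gt_atTop 0] with n hng hn1 hns hn u hu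
  have hclose : ∀ x ∈ Set.Icc (0 : ℝ) 1, u (idx n x) ∈ Set.Icc (0 : ℝ) 1 ∧
      |u (idx n x) - x| < min δ δ' := fun x hx =>
    ⟨Iseg_subset_Icc (idx_lt hn x) (hu _ (idx_lt hn x)),
      (abs_sub_le_of_mem_Iseg_idx hn hx (hu _ (idx_lt hn x))).trans_lt hns⟩
  -- The step kernel applied to a bounded continuous function, as a function of the row index.
  set S : (ℝ → ℝ) → ℕ → ℝ := fun ψ i => ∫ v, (ξ n i (idx n v) : ℝ) * ψ v ∂unif01 with hS
  have hξint : ∀ (i : ℕ) {ψ : ℝ → ℝ}, Continuous ψ → (∃ C, ∀ v, |ψ v| ≤ C) →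
      Integrable (fun v => (ξ n i (idx n v) : ℝ) * ψ v) unif01 := fun i ψ hψ ⟨C, hC⟩ =>
    (integrable_comp_idx hn fun j => (ξ n i j : ℝ)).mul_bdd (c := C)
      hψ.aestronglyMeasurable (ae_of_all _ hC)
  have hWψ : ∀ u ∈ Set.Icc (0 : ℝ) 1, ∀ {ψ : ℝ → ℝ}, Continuous ψ → (∃ C, ∀ v, |ψ v| ≤ C) →
      Integrable (fun v => W u v * ψ v) unif01 := fun u hu ψ hψ ⟨C, hC⟩ =>
    (hWslice u hu).mul_bdd (c := C) hψ.aestronglyMeasurable (ae_of_all _ hC)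
  have hdiff : ∀ x ∈ Set.Icc (0 : ℝ) 1, ∀ {ψ : ℝ → ℝ}, Continuous ψ → (∃ C, ∀ v, |ψ v| ≤ C) →
      ∫ v, (Wstep n (ξ n) x v - W x v) * ψ v ∂unif01
        = S ψ (idx n x) - ∫ v, W x v * ψ v ∂unif01 := by
    intro x hx ψ hψ hC
    rw [hS, ← integral_sub (hξint _ hψ hC) (hWψ x hx hψ hC)]
    simp only [Wstep, sub_mul]
  have hDint : ∀ {ψ : ℝ → ℝ}, Continuous ψ → (∃ C, ∀ v, |ψ v| ≤ C) →
      Integrable (fun x => |∫ v, (Wstep n (ξ n) x v - W x v) * ψ v ∂unif01|) unif01 := by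
    intro ψ hψ hC
    refine (((integrable_comp_idx hn (S ψ)).sub
      (hWcont ψ hψ).integrable_unif01).abs).congr ?_
    filter_upwards [ae_unif01_mem_Icc] with x hx
    rw [hdiff x hx hψ hC]
    rfl
  have hgC : ∃ C, ∀ v, |g v| ≤ C := ⟨B, hB⟩
  have hone : ∃ C, ∀ v : ℝ, |(fun _ : ℝ => (1 : ℝ)) v| ≤ C := ⟨1, by simp⟩
  set F : ℕ → ℝ := fun i =>
    |(1 / (n : ℝ)) * ∑ j ∈ Finset.range n, (ξ n i j : ℝ) * g (u j) - G (u i)| with hF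
  have hpt : ∀ x ∈ Set.Icc (0 : ℝ) 1, F (idx n x) ≤
      |∫ v, (Wstep n (ξ n) x v - W x v) * g v ∂unif01|
        + η * |∫ v, (Wstep n (ξ n) x v - W x v) * (fun _ => 1) v ∂unif01| + (η + η * B₁) := by
    intro x hx
    rw [hdiff x hx hg hgC, hdiff x hx continuous_const hone]
    set i := idx n x with hi
    have h1 : |G x - G (u i)| ≤ η := by
      rw [abs_sub_comm]
      exact (hδ _ (hclose x hx).1 x hx ((hclose x hx).2.trans_le (min_le_left _ _))).le
    have h2 : |(1 / (n : ℝ)) * ∑ j ∈ Finset.range n, (ξ n i j : ℝ) * g (u j) - S g i|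
        ≤ η * S (fun _ => 1) i := by
      rw [← integral_comp_idx hn fun j => (ξ n i j : ℝ) * g (u j), hS,
        ← integral_sub (integrable_comp_idx hn fun j => (ξ n i j : ℝ) * g (u j))
          (hξint i hg hgC), ← integral_const_mul]
      refine abs_integral_le_integral_abs.trans (integral_mono_ae
        (((integrable_comp_idx hn fun j => (ξ n i j : ℝ) * g (u j)).sub (hξint i hg hgC)).abs)
        ((hξint i continuous_const hone).const_mul η) ?_)
      filter_upwards [ae_unif01_mem_Icc] with v hv
      have := (hδ' _ (hclose v hv).1 v hv ((hclose v hv).2.trans_le (min_le_right _ _))).le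
      rw [← mul_sub, abs_mul, NNReal.abs_eq, mul_one, mul_comm]
      gcongr
    have h3 : S (fun _ => 1) i ≤ |S (fun _ => 1) i - G₁ x| + B₁ := by
      have := le_abs_self (S (fun _ => 1) i - G₁ x)
      have := (le_abs_self (G₁ x)).trans (hB₁ x hx)
      linarith
    have h4 : η * S (fun _ => 1) i ≤ η * |S (fun _ => 1) i - G₁ x| + η * B₁ := by
      rw [← mul_add]
      gcongr
    calc F i = |((1 / (n : ℝ)) * ∑ j ∈ Finset.range n, (ξ n i j : ℝ) * g (u j) - S g i)
          + (S g i - G x) + (G x - G (u i))| := by simp only [hF]; congr 1; ring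
      _ ≤ _ := abs_add_three _ _ _
      _ ≤ _ := by linarith
  have hI1 := hDint hg hgC
  have hI2 := (hDint continuous_const hone).const_mul η
  have hI12 : Integrable (fun x => |∫ v, (Wstep n (ξ n) x v - W x v) * g v ∂unif01|
      + η * |∫ v, (Wstep n (ξ n) x v - W x v) * (fun _ => 1) v ∂unif01|) unif01 := hI1.add hI2
  calc (1 / (n : ℝ)) * ∑ i ∈ Finset.range n, F i = ∫ x, F (idx n x) ∂unif01 :=
        (integral_comp_idx hn F).symm
    _ ≤ ∫ x, (|∫ v, (Wstep n (ξ n) x v - W x v) * g v ∂unif01|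
        + η * |∫ v, (Wstep n (ξ n) x v - W x v) * (fun _ => 1) v ∂unif01|
        + (η + η * B₁)) ∂unif01 := by
        refine integral_mono_ae (integrable_comp_idx hn F)
          (hI12.add (integrable_const _)) ?_
        filter_upwards [ae_unif01_mem_Icc] with x hx using hpt x hx
    _ = ∫ x, |∫ v, (Wstep n (ξ n) x v - W x v) * g v ∂unif01| ∂unif01
        + η * ∫ x, |∫ v, (Wstep n (ξ n) x v - W x v) * (fun _ => 1) v ∂unif01| ∂unif01
        + (η + η * B₁) := by
        rw [integral_add hI12 (integrable_const _), integral_add hI1 hI2,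
          integral_const_mul]
        simp
    _ < η + η * 1 + (η + η * B₁) := by gcongr
    _ ≤ η * (4 + B₁) := by nlinarith
    _ = ε := by rw [hη]; field_simp

/-- The weighted empirical measure `(1/n) Σⱼ wⱼ δ_{xⱼ}`. -/
def weightedEmpirical {E : Type*} [MeasurableSpace E] {n : ℕ} (w : Fin n → ℝ≥0) (x : Fin n → E) :
    FiniteMeasure E :=
  ((n : ℝ≥0))⁻¹ • (∑ j : Fin n, (w j • diracFM (x j) : FiniteMeasure E) : FiniteMeasure E)

theorem testAgainstNN_weightedEmpirical {E : Type*} [MeasurableSpace E] [TopologicalSpace E]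
    [OpensMeasurableSpace E] {n : ℕ} (w : Fin n → ℝ≥0) (x : Fin n → E)
    (φ : BoundedContinuousFunction E ℝ≥0) :
    ((weightedEmpirical w x).testAgainstNN φ : ℝ) = ∑ j, (w j / n : ℝ) * φ (x j) := by
  have hφ : Measurable fun x => (φ x : ℝ≥0∞) :=
    measurable_coe_nnreal_ennreal.comp φ.continuous.measurable
  have hsum : (∑ j : Fin n, (w j • diracFM (x j) : FiniteMeasure E)).testAgainstNN φ
      = ∑ j, w j * φ (x j) := by
    rw [← ENNReal.coe_inj, FiniteMeasure.testAgainstNN_coe_eq, FiniteMeasure.toMeasure_sum,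
      lintegral_finsetSum_measure, ENNReal.ofNNReal_finsetSum]
    refine Finset.sum_congr rfl fun j _ => ?_
    rw [← FiniteMeasure.testAgainstNN_coe_eq, FiniteMeasure.smul_testAgainstNN_apply, smul_eq_mul,
      ENNReal.coe_mul, ENNReal.coe_mul, FiniteMeasure.testAgainstNN_coe_eq]
    congr 1
    exact lintegral_dirac' _ hφ
  rw [weightedEmpirical, FiniteMeasure.smul_testAgainstNN_apply, hsum, smul_eq_mul]
  push_cast
  rw [Finset.mul_sum]
  exact Finset.sum_congr rfl fun j _ => by ring

theorem testAgainstNN_toFiniteMeasure_eq_integral {E : Type*} [MeasurableSpace E]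
    [TopologicalSpace E] [OpensMeasurableSpace E] (p : ProbabilityMeasure E)
    (φ : BoundedContinuousFunction E ℝ≥0) :
    (p.toFiniteMeasure.testAgainstNN φ : ℝ) = ∫ x, (φ x : ℝ) ∂(p : Measure E) :=
  BoundedContinuousFunction.toReal_lintegral_coe_eq_integral φ (p : Measure E)

section Neighborhood

variable {E : Type*} [MeasurableSpace E] [TopologicalSpace E] [OpensMeasurableSpace E]
  {μ : Measure (ℝ × E)} {W : ℝ → ℝ → ℝ} {κ : ℝ → ProbabilityMeasure E}

theorem continuousOn_testAgainstNN (hκc : ContinuousOn κ (Set.Icc (0 : ℝ) 1))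
    (φ : BoundedContinuousFunction E ℝ≥0) :
    ContinuousOn (fun v => ((κ v).toFiniteMeasure.testAgainstNN φ : ℝ)) (Set.Icc (0 : ℝ) 1) :=
  (NNReal.continuous_coe.comp ((FiniteMeasure.continuous_testAgainstNN_eval φ).comp
    ProbabilityMeasure.toFiniteMeasure_continuous)).comp_continuousOn hκc

/-- The weak moments of a continuous disintegration have a bounded continuous extension to the whole
line. -/
theorem exists_continuous_extension_testAgainstNN (hκc : ContinuousOn κ (Set.Icc (0 : ℝ) 1))
    (φ : BoundedContinuousFunction E ℝ≥0) :
    ∃ g : ℝ → ℝ, Continuous g ∧ (∃ B, ∀ v, |g v| ≤ B) ∧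
      ∀ v ∈ Set.Icc (0 : ℝ) 1, g v = ((κ v).toFiniteMeasure.testAgainstNN φ : ℝ) := by
  have hc := continuousOn_testAgainstNN hκc φ
  obtain ⟨B, hB⟩ := isCompact_Icc.exists_bound_of_continuousOn hc
  refine ⟨IccExtend zero_le_one ((Set.Icc (0 : ℝ) 1).domRestrict
    fun v => ((κ v).toFiniteMeasure.testAgainstNN φ : ℝ)),
    hc.domRestrict.Icc_extend', ⟨B, fun v => ?_⟩, fun v hv => ?_⟩
  · exact hB _ (projIcc (0 : ℝ) 1 zero_le_one v).2
  · rw [IccExtend_of_mem _ _ hv]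
    rfl

theorem testAgainstNN_Wfin_eq_integral_extension
    (hWmeas : Measurable fun p : ℝ × ℝ => W p.1 p.2)
    (hWnonneg : ∀ᵐ p ∂unif01.prod unif01, 0 ≤ W p.1 p.2)
    (hWslice : ∀ u ∈ Set.Icc (0 : ℝ) 1, Integrable (W u) unif01)
    (hWcont : ∀ g : ℝ → ℝ, Continuous g →
      ContinuousOn (fun u => ∫ v, W u v * g v ∂unif01) (Set.Icc (0 : ℝ) 1))
    (hκ : Measurable fun u => (κ u : Measure E))
    (hdis : μ = unif01.bind fun u => (κ u : Measure E).map fun x => (u, x))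
    {φ : BoundedContinuousFunction E ℝ≥0} {g : ℝ → ℝ}
    (hg : ∀ v ∈ Set.Icc (0 : ℝ) 1, g v = ((κ v).toFiniteMeasure.testAgainstNN φ : ℝ))
    {u : ℝ} (hu : u ∈ Set.Icc (0 : ℝ) 1) :
    ((Wfin W μ u).testAgainstNN φ : ℝ) = ∫ v, W u v * g v ∂unif01 := by
  rw [testAgainstNN_Wfin hκ hdis hWmeas.of_uncurry_left (hWslice u hu)
    (ae_nonneg_slice_of_continuous hWmeas hWnonneg hWslice hWcont hu)]
  refine integral_congr_ae ?_
  filter_upwards [ae_unif01_mem_Icc] with v hv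
  rw [hg v hv]

theorem continuousOn_Wfin
    (hWmeas : Measurable fun p : ℝ × ℝ => W p.1 p.2)
    (hWnonneg : ∀ᵐ p ∂unif01.prod unif01, 0 ≤ W p.1 p.2)
    (hWslice : ∀ u ∈ Set.Icc (0 : ℝ) 1, Integrable (W u) unif01)
    (hWcont : ∀ g : ℝ → ℝ, Continuous g →
      ContinuousOn (fun u => ∫ v, W u v * g v ∂unif01) (Set.Icc (0 : ℝ) 1))
    (hκ : Measurable fun u => (κ u : Measure E))
    (hdis : μ = unif01.bind fun u => (κ u : Measure E).map fun x => (u, x))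
    (hκc : ContinuousOn κ (Set.Icc (0 : ℝ) 1)) :
    ContinuousOn (Wfin W μ) (Set.Icc (0 : ℝ) 1) := by
  intro u hu
  refine FiniteMeasure.tendsto_iff_forall_testAgainstNN_tendsto.2 fun φ => ?_
  obtain ⟨g, hgc, -, hg⟩ := exists_continuous_extension_testAgainstNN hκc φ
  have heq : ∀ t ∈ Set.Icc (0 : ℝ) 1, ((Wfin W μ t).testAgainstNN φ : ℝ)
      = ∫ v, W t v * g v ∂unif01 := fun t ht =>
    testAgainstNN_Wfin_eq_integral_extension hWmeas hWnonneg hWslice hWcont hκ hdis hg ht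
  rw [← NNReal.tendsto_coe, heq u hu]
  refine (hWcont g hgc u hu).congr' ?_
  filter_upwards [self_mem_nhdsWithin] with t ht using (heq t ht).symm

/-- Averaged convergence of the neighborhood empirical measures against one test function. -/
theorem eventually_average_integral_abs_testAgainstNN_sub_le
    (hWmeas : Measurable fun p : ℝ × ℝ => W p.1 p.2)
    (hWnonneg : ∀ᵐ p ∂unif01.prod unif01, 0 ≤ W p.1 p.2)
    (hWslice : ∀ u ∈ Set.Icc (0 : ℝ) 1, Integrable (W u) unif01)
    (hWcont : ∀ g : ℝ → ℝ, Continuous g →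
      ContinuousOn (fun u => ∫ v, W u v * g v ∂unif01) (Set.Icc (0 : ℝ) 1))
    (hκ : Measurable fun u => (κ u : Measure E))
    (hdis : μ = unif01.bind fun u => (κ u : Measure E).map fun x => (u, x))
    (hκc : ContinuousOn κ (Set.Icc (0 : ℝ) 1))
    {ξ : ℕ → ℕ → ℕ → ℝ≥0} (hconv : StrongOpTendsto (fun n => Wstep n (ξ n)) W)
    (hξsq : Tendsto (fun n : ℕ => (1 / (n : ℝ) ^ 3) *
      ∑ i ∈ Finset.range n, ∑ j ∈ Finset.range n, (ξ n i j : ℝ) ^ 2) atTop (𝓝 0))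
    (φ : BoundedContinuousFunction E ℝ≥0) {η : ℝ} (hη : 0 < η) :
    ∀ᶠ n : ℕ in atTop, ∀ u : Fin n → ℝ, (∀ i : Fin n, u i ∈ Iseg n i) →
      (∀ i : Fin n, Integrable (fun x : Fin n → E =>
        |((weightedEmpirical (fun j : Fin n => ξ n i j) x).testAgainstNN φ : ℝ)
          - (Wfin W μ (u i)).testAgainstNN φ|)
        (Measure.pi fun j : Fin n => (κ (u j) : Measure E))) ∧
      (1 / (n : ℝ)) * ∑ i : Fin n, ∫ x : Fin n → E,
        |((weightedEmpirical (fun j : Fin n => ξ n i j) x).testAgainstNN φ : ℝ)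
          - (Wfin W μ (u i)).testAgainstNN φ|
        ∂(Measure.pi fun j : Fin n => (κ (u j) : Measure E)) ≤ 3 * η := by
  obtain ⟨g, hgc, ⟨Bg, hBg⟩, hg⟩ := exists_continuous_extension_testAgainstNN hκc φ
  set B : ℝ := ((nndist φ 0 : ℝ≥0) : ℝ)
  have hB : ∀ x, |(φ x : ℝ)| ≤ B := fun x => by
    rw [NNReal.abs_eq]
    exact_mod_cast BoundedContinuousFunction.NNReal.upper_bound φ x
  have hφm : Measurable fun x => (φ x : ℝ) :=
    measurable_coe_nnreal_real.comp φ.continuous.measurable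
  have hsq : ∀ᶠ n : ℕ in atTop, B ^ 2 / η * ((1 / (n : ℝ) ^ 3) *
      ∑ i ∈ Finset.range n, ∑ j ∈ Finset.range n, (ξ n i j : ℝ) ^ 2) < η := by
    have := hξsq.const_mul (B ^ 2 / η)
    rw [mul_zero] at this
    exact this.eventually (gt_mem_nhds hη)
  filter_upwards [hsq, hconv.discrete hWslice hWcont hgc hBg hη, eventually_gt_atTop 0]
    with n hn1 hn2 hn u hu
  have hn' : (0 : ℝ) < n := Nat.cast_pos.2 hn
  set P : Measure (Fin n → E) := Measure.pi fun j : Fin n => (κ (u j) : Measure E) with hP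
  have hu01 : ∀ i, u i ∈ Set.Icc (0 : ℝ) 1 := fun i => Iseg_subset_Icc i.2 (hu i)
  set a : Fin n → Fin n → ℝ := fun i j => (ξ n i j : ℝ) / n with ha
  set G : ℝ → ℝ := fun t => ∫ v, W t v * g v ∂unif01 with hG
  have hint : ∀ j, ∫ y, (φ y : ℝ) ∂(κ (u j) : Measure E) = g (u j) := fun j => by
    rw [hg _ (hu01 j), testAgainstNN_toFiniteMeasure_eq_integral]
  have hemp : ∀ (i : Fin n) (x : Fin n → E),
      |((weightedEmpirical (fun j : Fin n => ξ n i j) x).testAgainstNN φ : ℝ)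
        - (Wfin W μ (u i)).testAgainstNN φ| = |∑ j, a i j * φ (x j) - G (u i)| := fun i x => by
    rw [testAgainstNN_weightedEmpirical, testAgainstNN_Wfin_eq_integral_extension hWmeas hWnonneg
      hWslice hWcont hκ hdis hg (hu01 i)]
  simp only [hemp]
  have hcheb := fun i => integral_abs_sum_sub_le (fun j => (κ (u j) : Measure E)) hφm hB (a i) hη
  simp only [hint] at hcheb
  have hI : ∀ i, Integrable (fun x : Fin n → E => |∑ j, a i j * (φ (x j) : ℝ) - G (u i)|) P := by
    intro i
    refine Integrable.abs (Integrable.sub (integrable_finsetSum _ fun j _ => ?_)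
      (integrable_const _))
    have hm : Measurable fun x : Fin n → E => (φ (x j) : ℝ) := hφm.comp (measurable_pi_apply j)
    exact (Integrable.of_bound hm.aestronglyMeasurable B
      (ae_of_all _ fun x => hB (x j))).const_mul _
  refine ⟨hI, ?_⟩
  have hone : ∀ i, ∫ x : Fin n → E, |∑ j, a i j * (φ (x j) : ℝ) - G (u i)| ∂P
      ≤ η + B ^ 2 / η * ∑ j, a i j ^ 2 + |∑ j, a i j * g (u j) - G (u i)| := by
    intro i
    calc ∫ x : Fin n → E, |∑ j, a i j * (φ (x j) : ℝ) - G (u i)| ∂P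
        ≤ ∫ x : Fin n → E, (|∑ j, a i j * (φ (x j) : ℝ) - ∑ j, a i j * g (u j)|
            + |∑ j, a i j * g (u j) - G (u i)|) ∂P :=
          integral_mono (hI i) ((hcheb i).1.add (integrable_const _)) fun x =>
            abs_sub_le _ _ _
      _ = ∫ x : Fin n → E, |∑ j, a i j * (φ (x j) : ℝ) - ∑ j, a i j * g (u j)| ∂P
            + |∑ j, a i j * g (u j) - G (u i)| := by
          rw [integral_add (hcheb i).1 (integrable_const _), integral_const, probReal_univ, one_smul]
      _ ≤ _ := by
          gcongr
          exact (hcheb i).2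
  -- The labels extended by zero, to pass to sums over initial segments of `ℕ`.
  set u' : ℕ → ℝ := fun k => if hk : k < n then u ⟨k, hk⟩ else 0 with hu'
  have hu'u : ∀ i : Fin n, u' i = u i := fun i => by simp [hu']
  have hdet := hn2 u' fun i hi => by
    rw [show u' i = u ⟨i, hi⟩ from hu'u ⟨i, hi⟩]
    exact hu ⟨i, hi⟩
  simp only [Finset.sum_range] at hdet hn1
  simp only [hu'u] at hdet
  have hdet' : (1 / (n : ℝ)) * ∑ i, |∑ j, a i j * g (u j) - G (u i)| < η := by
    refine lt_of_eq_of_lt ?_ hdet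
    congr 1
    refine Finset.sum_congr rfl fun i _ => ?_
    rw [Finset.mul_sum]
    congr 2
    exact Finset.sum_congr rfl fun j _ => by simp only [ha]; ring
  have hsq' : (1 / (n : ℝ)) * ∑ i, B ^ 2 / η * ∑ j, a i j ^ 2 < η := by
    refine lt_of_eq_of_lt ?_ hn1
    simp only [ha, div_pow, ← Finset.sum_div, ← Finset.mul_sum]
    field_simp
  calc (1 / (n : ℝ)) * ∑ i, ∫ x : Fin n → E, |∑ j, a i j * (φ (x j) : ℝ) - G (u i)| ∂P
      ≤ (1 / (n : ℝ)) * ∑ i, (η + B ^ 2 / η * ∑ j, a i j ^ 2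
          + |∑ j, a i j * g (u j) - G (u i)|) := by
        gcongr with i
        exact hone i
    _ = η + (1 / (n : ℝ)) * ∑ i, B ^ 2 / η * ∑ j, a i j ^ 2
          + (1 / (n : ℝ)) * ∑ i, |∑ j, a i j * g (u j) - G (u i)| := by
        rw [Finset.sum_add_distrib, Finset.sum_add_distrib, mul_add, mul_add]
        simp only [Finset.sum_const, Finset.card_univ, Fintype.card_fin, nsmul_eq_mul]
        field_simp
    _ ≤ 3 * η := by linarith

end Neighborhood


/-- Theorem on continuous kernels.  Under: strong operator convergence
`W_{ξⁿ} → W`, `(1/n³) Σ (ξⁿᵢⱼ)² → 0`, weak continuity of `u ↦ W(u,v)dv`, weak continuity of the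
disintegration `u ↦ μ_u`, and `h : [0,1] × M₊(E) → ℝ` bounded measurable with `h(u,·)`
continuous uniformly in `u`, one has
`sup_{u ∈ Iⁿ₁×⋯×Iⁿₙ} (1/n) Σᵢ E|h(uᵢ, Mⁿᵢ(u)) − h(uᵢ, Wμ(uᵢ))| → 0`, where
`Mⁿᵢ(u) = (1/n) Σⱼ ξⁿᵢⱼ δ_{X_{uⱼ}}` and the `X_{uⱼ} ~ μ_{uⱼ}` are independent. -/
theorem neighborhood_empirical_measure_convergence_continuous
    {E : Type*} [MetricSpace E] [PolishSpace E] [MeasurableSpace E] [BorelSpace E]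
    (μ : Measure (ℝ × E)) [IsProbabilityMeasure μ] (hμfst : μ.map Prod.fst = unif01)
    (W : ℝ → ℝ → ℝ)
    (hWmeas : Measurable fun p : ℝ × ℝ => W p.1 p.2)
    (hWint : Integrable (fun p : ℝ × ℝ => W p.1 p.2) (unif01.prod unif01))
    (hWnonneg : ∀ᵐ p ∂unif01.prod unif01, 0 ≤ W p.1 p.2)
    (hWslice : ∀ u ∈ Set.Icc (0:ℝ) 1, Integrable (W u) unif01)
    (hWcont : ∀ g : ℝ → ℝ, Continuous g →
      ContinuousOn (fun u => ∫ v, W u v * g v ∂unif01) (Set.Icc (0:ℝ) 1))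
    (μd : ℝ → ProbabilityMeasure E)
    (hμdmeas : Measurable fun u => (μd u : Measure E))
    (hdisint : μ = unif01.bind fun u => (μd u : Measure E).map fun x => (u, x))
    (hμdcont : ContinuousOn μd (Set.Icc (0:ℝ) 1))
    (ξ : ℕ → ℕ → ℕ → ℝ≥0) (hξdiag : ∀ n i, ξ n i i = 0)
    (hconv : StrongOpTendsto (fun n => Wstep n (ξ n)) W)
    (hξsq : Tendsto (fun n : ℕ => (1 / (n : ℝ) ^ 3) *
      ∑ i ∈ Finset.range n, ∑ j ∈ Finset.range n, (ξ n i j : ℝ) ^ 2) atTop (𝓝 0))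
    (h : ℝ → FiniteMeasure E → ℝ)
    (hhmeas : Measurable fun p : ℝ × FiniteMeasure E => h p.1 p.2)
    (hhbdd : ∃ C, ∀ u m, |h u m| ≤ C)
    (hhcont : ∀ m : FiniteMeasure E, ∀ ε > (0:ℝ),
      ∀ᶠ m' in 𝓝 m, ∀ u ∈ Set.Icc (0:ℝ) 1, |h u m' - h u m| ≤ ε) :
    ∀ ε > (0:ℝ), ∃ N : ℕ, ∀ n ≥ N, ∀ u : Fin n → ℝ, (∀ i : Fin n, u i ∈ Iseg n i) →
      (1 / (n : ℝ)) * ∑ i : Fin n,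
          ∫ x : Fin n → E,
            |h (u i) (((n : ℝ≥0))⁻¹ • (∑ j : Fin n,
                (ξ n i j • diracFM (x j) : FiniteMeasure E) : FiniteMeasure E))
              - h (u i) (Wfin W μ (u i))|
            ∂(Measure.pi fun j : Fin n => (μd (u j) : Measure E))
        < ε := by
  obtain ⟨C, hC⟩ := hhbdd
  have hC0 : 0 ≤ C := (abs_nonneg _).trans (hC 0 0)
  intro ε hε
  obtain ⟨Φ, δ, hδ, hΦ⟩ := exists_finset_test_uniform (I := Set.Icc (0 : ℝ) 1) hhcont isCompact_Icc
    (continuousOn_Wfin hWmeas hWnonneg hWslice hWcont hμdmeas hdisint hμdcont)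
    (ε := ε / 4) (by positivity)
  set η : ℝ := ε * δ / (12 * (C + 1) * (Φ.card + 1)) with hη
  have hη0 : 0 < η := by positivity
  have hev := (Filter.eventually_all_finset Φ).2 fun φ _ =>
    eventually_average_integral_abs_testAgainstNN_sub_le hWmeas hWnonneg hWslice hWcont hμdmeas
      hdisint hμdcont hconv hξsq φ hη0
  obtain ⟨N, hN⟩ := eventually_atTop.1 (hev.and (eventually_gt_atTop 0))
  refine ⟨N, fun n hnN u hu => ?_⟩
  obtain ⟨htest, hn⟩ := hN n hnN
  have hn' : (0 : ℝ) < n := Nat.cast_pos.2 hn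
  have hu01 : ∀ i, u i ∈ Set.Icc (0 : ℝ) 1 := fun i => Iseg_subset_Icc i.2 (hu i)
  set P : Measure (Fin n → E) := Measure.pi fun j : Fin n => (μd (u j) : Measure E) with hP
  set M : Fin n → (Fin n → E) → FiniteMeasure E := fun i x =>
    weightedEmpirical (fun j : Fin n => ξ n i j) x with hM
  set D : BoundedContinuousFunction E ℝ≥0 → Fin n → (Fin n → E) → ℝ := fun φ i x =>
    |((M i x).testAgainstNN φ : ℝ) - (Wfin W μ (u i)).testAgainstNN φ| with hD
  have hDint : ∀ φ ∈ Φ, ∀ i, Integrable (D φ i) P := fun φ hφ => (htest φ hφ u hu).1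
  have hDavg : ∀ φ ∈ Φ, (1 / (n : ℝ)) * ∑ i, ∫ x, D φ i x ∂P ≤ 3 * η := fun φ hφ =>
    (htest φ hφ u hu).2
  have hpt : ∀ i x, |h (u i) (M i x) - h (u i) (Wfin W μ (u i))|
      ≤ ε / 4 + 2 * C / δ * ∑ φ ∈ Φ, D φ i x := by
    intro i x
    by_cases hclose : ∀ φ ∈ Φ, D φ i x < δ
    · have h1 := hΦ (u i) (hu01 i) (M i x) hclose (u i) (hu01 i)
      have h2 : 0 ≤ 2 * C / δ * ∑ φ ∈ Φ, D φ i x :=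
        mul_nonneg (by positivity) (Finset.sum_nonneg fun φ _ => abs_nonneg _)
      linarith
    · push Not at hclose
      obtain ⟨φ, hφ, hφδ⟩ := hclose
      have h1 : δ ≤ ∑ φ ∈ Φ, D φ i x :=
        hφδ.trans (Finset.single_le_sum (f := fun φ => D φ i x) (fun φ _ => abs_nonneg _) hφ)
      have h2 : 2 * C ≤ 2 * C / δ * ∑ φ ∈ Φ, D φ i x := by
        calc 2 * C = 2 * C / δ * δ := by field_simp
          _ ≤ _ := by gcongr
      have h3 := abs_sub (h (u i) (M i x)) (h (u i) (Wfin W μ (u i)))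
      linarith [hC (u i) (M i x), hC (u i) (Wfin W μ (u i))]
  have hbound : ∀ i, ∫ x, |h (u i) (M i x) - h (u i) (Wfin W μ (u i))| ∂P
      ≤ ε / 4 + 2 * C / δ * ∑ φ ∈ Φ, ∫ x, D φ i x ∂P := by
    intro i
    have hsum : Integrable (fun x => 2 * C / δ * ∑ φ ∈ Φ, D φ i x) P :=
      (integrable_finsetSum _ fun φ hφ => hDint φ hφ i).const_mul _
    calc ∫ x, |h (u i) (M i x) - h (u i) (Wfin W μ (u i))| ∂P
        ≤ ∫ x, (ε / 4 + 2 * C / δ * ∑ φ ∈ Φ, D φ i x) ∂P :=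
          integral_mono_of_nonneg (ae_of_all _ fun x => abs_nonneg _)
            ((integrable_const _).add hsum) (ae_of_all _ (hpt i))
      _ = _ := by
          rw [integral_add (integrable_const _) hsum, integral_const_mul,
            integral_finsetSum _ fun φ hφ => hDint φ hφ i]
          simp
  calc (1 / (n : ℝ)) * ∑ i, ∫ x, |h (u i) (M i x) - h (u i) (Wfin W μ (u i))| ∂P
      ≤ (1 / (n : ℝ)) * ∑ i, (ε / 4 + 2 * C / δ * ∑ φ ∈ Φ, ∫ x, D φ i x ∂P) := by
        gcongr with i
        exact hbound i
    _ = ε / 4 + 2 * C / δ * ∑ φ ∈ Φ, (1 / (n : ℝ)) * ∑ i, ∫ x, D φ i x ∂P := by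
        rw [Finset.sum_add_distrib, ← Finset.mul_sum, Finset.sum_comm, ← Finset.mul_sum]
        simp only [Finset.sum_const, Finset.card_univ, Fintype.card_fin, nsmul_eq_mul]
        field_simp
    _ ≤ ε / 4 + 2 * C / δ * ∑ _φ ∈ Φ, 3 * η := by
        have := Finset.sum_le_sum hDavg
        gcongr
    _ = ε / 4 + ε / 2 * (C / (C + 1) * (Φ.card / (Φ.card + 1))) := by
        rw [Finset.sum_const, nsmul_eq_mul, hη]
        field_simp
        ring
    _ ≤ ε / 4 + ε / 2 * (1 * 1) := by
        gcongr
        · exact (div_le_one (by positivity)).2 (by linarith)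
        · exact (div_le_one (by positivity)).2 (by linarith)
    _ < ε := by linarith

end
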